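/- Let (X, T) be a reduced-form mechanism for a single-minded capacitated seller that is Bayesian incentive compatible and interim individually rational. Fix q ∈ [q̲,q̄] and let f : [c̲,c̄] → ℝ be a conditional density with f(c) > 0 for all c, f integrable, ∫_{c̲}^{c̄} f = 1, F(c) = ∫_{c̲}^c f(s) ds, and virtual cost H(c,q) = c + F(c)/f(c). Then the expected payment is bounded below by the expected virtual cost: ∫_{c̲}^{c̄} T(c,q) f(c) dc ≥ ∫_{c̲}^{c̄} H(c,q) X(c,q) f(c) dc, with equality if and only if ρ(c̄,q) = 0. -/

import Mathlib

open Set MeasureTheory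

section Subgradient

variable {r x : ℝ → ℝ} {a b : ℝ}

/-- The negative of a selection of subgradients is antitone. -/
theorem antitoneOn_of_subgradient
    (h : ∀ s ∈ Icc a b, ∀ t ∈ Icc a b, r t - (s - t) * x t ≤ r s) :
    AntitoneOn x (Icc a b) := by
  intro s hs t ht hst
  rcases hst.eq_or_lt with rfl | hlt
  · exact le_rfl
  · have h₁ := h s hs t ht
    have h₂ := h t ht s hs
    by_contra! hx
    nlinarith [mul_pos (sub_pos.2 hlt) (sub_pos.2 hx)]

/-- A function with a selection of subgradients on a compact interval is absolutely continuous
there. -/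
theorem absolutelyContinuousOnInterval_of_subgradient (hab : a ≤ b)
    (h : ∀ s ∈ Icc a b, ∀ t ∈ Icc a b, r t - (s - t) * x t ≤ r s) :
    AbsolutelyContinuousOnInterval r a b := by
  have hx := antitoneOn_of_subgradient h
  have hbound : ∀ t ∈ Icc a b, |x t| ≤ max |x b| |x a| := fun t ht ↦
    abs_le_max_abs_abs (hx ht (right_mem_Icc.2 hab) ht.2) (hx (left_mem_Icc.2 hab) ht ht.1)
  refine LipschitzOnWith.absolutelyContinuousOnInterval (K := Real.toNNReal (max |x b| |x a|)) ?_
  rw [uIcc_of_le hab]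
  refine LipschitzOnWith.of_le_add_mul' _ fun s hs t ht ↦ ?_
  have hmul : (t - s) * x s ≤ max |x b| |x a| * dist s t := by
    calc (t - s) * x s ≤ |t - s| * |x s| := (le_abs_self _).trans (abs_mul _ _).le
      _ ≤ |t - s| * max |x b| |x a| := by gcongr; exact hbound s hs
      _ = max |x b| |x a| * dist s t := by rw [Real.dist_eq, abs_sub_comm, mul_comm]
  linarith [h t ht s hs]

/-- At an interior point of differentiability the subgradient is the derivative. -/
theorem deriv_eq_neg_of_subgradient {c : ℝ} (hc : c ∈ Ioo a b) (hr : DifferentiableAt ℝ r c)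
    (h : ∀ s ∈ Icc a b, r c - (s - c) * x c ≤ r s) : deriv r c = -x c := by
  have hmin : IsLocalMin (fun s ↦ r s + (s - c) * x c) c := by
    filter_upwards [Icc_mem_nhds hc.1 hc.2] with s hs
    linarith [h s hs]
  have hd := hr.hasDerivAt.add (((hasDerivAt_id c).sub_const c).mul_const (x c))
  have h0 := hmin.hasDerivAt_eq_zero hd
  linarith

/-- Integration by parts against a density: the expectation of `r` is its terminal value plus the
integral of its negated subgradient weighted by the cumulative distribution. -/
theorem integral_mul_eq_of_subgradient {f : ℝ → ℝ} (hab : a ≤ b)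
    (h : ∀ s ∈ Icc a b, ∀ t ∈ Icc a b, r t - (s - t) * x t ≤ r s)
    (hf : IntervalIntegrable f volume a b) :
    ∫ c in a..b, r c * f c =
      r b * (∫ s in a..b, f s) + ∫ c in a..b, x c * ∫ s in a..c, f s := by
  have hr := absolutelyContinuousOnInterval_of_subgradient hab h
  have hF := hf.absolutelyContinuousOnInterval_intervalIntegral (c := a) left_mem_uIcc
  have hparts := hr.integral_mul_deriv_eq_deriv_mul hF
  have hf_deriv : ∫ c in a..b, r c * deriv (fun u ↦ ∫ s in a..u, f s) c =
      ∫ c in a..b, r c * f c := by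
    refine intervalIntegral.integral_congr_ae ?_
    filter_upwards [hf.ae_hasDerivAt_integral] with c hc hcm
    rw [(hc (uIoc_subset_uIcc hcm) a left_mem_uIcc).deriv]
  have hr_deriv : ∫ c in a..b, deriv r c * ∫ s in a..c, f s =
      ∫ c in a..b, -(x c * ∫ s in a..c, f s) := by
    refine intervalIntegral.integral_congr_ae ?_
    filter_upwards [hr.ae_differentiableAt, Measure.ae_ne volume b] with c hc hcb hcm
    have hcd := hc (uIoc_subset_uIcc hcm)
    rw [uIoc_of_le hab] at hcm
    rw [deriv_eq_neg_of_subgradient ⟨hcm.1, lt_of_le_of_ne hcm.2 hcb⟩ hcd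
      fun s hs ↦ h s hs c ⟨hcm.1.le, hcm.2⟩]
    ring
  rw [hf_deriv, hr_deriv, intervalIntegral.integral_neg, intervalIntegral.integral_same] at hparts
  linarith

end Subgradient

/-- The product of an antitone function and an integrable function is integrable. -/
theorem AntitoneOn.intervalIntegrable_mul {x f : ℝ → ℝ} {a b : ℝ} (hab : a ≤ b)
    (hx : AntitoneOn x (Icc a b)) (hf : IntervalIntegrable f volume a b) :
    IntervalIntegrable (fun c ↦ x c * f c) volume a b := by
  have hxi : IntervalIntegrable x volume a b := by
    apply AntitoneOn.intervalIntegrable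
    rwa [uIcc_of_le hab]
  rw [intervalIntegrable_iff_integrableOn_Ioc_of_le hab] at hf hxi ⊢
  refine Integrable.bdd_mul (c := max |x b| |x a|) hf hxi.aestronglyMeasurable ?_
  filter_upwards [ae_restrict_mem measurableSet_Ioc] with t ht
  exact abs_le_max_abs_abs (hx ⟨ht.1.le, ht.2⟩ (right_mem_Icc.2 hab) ht.2)
    (hx (left_mem_Icc.2 hab) ⟨ht.1.le, ht.2⟩ ht.1.le)


/-- For a BIC and interim IR reduced-form mechanism `(X, T)` for a
single-minded capacitated seller, fixed capacity `q ∈ [q̲,q̄]`, and a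
positive conditional density `f` integrating to one with c.d.f. `F` and
virtual cost `H(c,q) = c + F(c)/f(c)`, the expected payment is bounded below
by the expected virtual cost:
`∫_{c̲}^{c̄} T(c,q) f(c) dc ≥ ∫_{c̲}^{c̄} H(c,q) X(c,q) f(c) dc`,
with equality iff `ρ(c̄,q) = 0`. -/
theorem expected_payment_ge_virtual_cost_of_bic_ir
    (cl cu ql qu : ℝ) (hc : cl < cu) (hq : ql ≤ qu)
    (X T : ℝ → ℝ → ℝ)
    (ρ : ℝ → ℝ → ℝ)
    (hρ : ∀ c q, ρ c q = T c q - c * X c q)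
    (U : ℝ × ℝ → ℝ × ℝ → ℝ)
    (hU : ∀ chat qhat c q, U (chat, qhat) (c, q) = ρ chat qhat - (c - chat) * X chat qhat)
    (hBIC : ∀ c ∈ Set.Icc cl cu, ∀ q ∈ Set.Icc ql qu,
        ∀ chat ∈ Set.Icc cl cu, ∀ qhat ∈ Set.Icc ql q,
          U (chat, qhat) (c, q) ≤ U (c, q) (c, q))
    (hIR : ∀ c ∈ Set.Icc cl cu, ∀ q ∈ Set.Icc ql qu, 0 ≤ U (c, q) (c, q))
    (q : ℝ) (hqmem : q ∈ Set.Icc ql qu)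
    (f : ℝ → ℝ)
    (hf_pos : ∀ c ∈ Set.Icc cl cu, 0 < f c)
    (hf_int : IntervalIntegrable f MeasureTheory.volume cl cu)
    (hf_one : (∫ s in cl..cu, f s) = 1)
    (F : ℝ → ℝ) (hF : ∀ c, F c = ∫ s in cl..c, f s)
    (H : ℝ → ℝ → ℝ) (hH : ∀ c, H c q = c + F c / f c) :
    (∫ c in cl..cu, H c q * X c q * f c) ≤ (∫ c in cl..cu, T c q * f c) ∧
    ((∫ c in cl..cu, T c q * f c) = (∫ c in cl..cu, H c q * X c q * f c) ↔
      ρ cu q = 0) := by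
  have hsub : ∀ s ∈ Icc cl cu, ∀ t ∈ Icc cl cu, ρ t q - (s - t) * X t q ≤ ρ s q := by
    intro s hs t ht
    simpa [hU] using hBIC s hs q hqmem t ht q ⟨hqmem.1, le_rfl⟩
  have hX := antitoneOn_of_subgradient hsub
  have hXi : IntervalIntegrable (X · q) volume cl cu := by
    apply AntitoneOn.intervalIntegrable
    rwa [uIcc_of_le hc.le]
  have hFcont : ContinuousOn F (uIcc cl cu) := by
    rw [funext hF]
    exact (hf_int.absolutelyContinuousOnInterval_intervalIntegral left_mem_uIcc).continuousOn
  have hρf : IntervalIntegrable (fun c ↦ ρ c q * f c) volume cl cu :=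
    hf_int.continuousOn_mul
      (absolutelyContinuousOnInterval_of_subgradient hc.le hsub).continuousOn
  have hcXf : IntervalIntegrable (fun c ↦ c * (X c q * f c)) volume cl cu :=
    (hX.intervalIntegrable_mul hc.le hf_int).continuousOn_mul continuousOn_id
  have hT : ∫ c in cl..cu, T c q * f c =
      (∫ c in cl..cu, ρ c q * f c) + ∫ c in cl..cu, c * (X c q * f c) := by
    rw [← intervalIntegral.integral_add hρf hcXf]
    congr 1 with c
    rw [hρ]
    ring
  have hHX : ∫ c in cl..cu, H c q * X c q * f c =
      (∫ c in cl..cu, X c q * F c) + ∫ c in cl..cu, c * (X c q * f c) := by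
    rw [← intervalIntegral.integral_add (hXi.mul_continuousOn hFcont) hcXf]
    refine intervalIntegral.integral_congr fun c hcm ↦ ?_
    rw [uIcc_of_le hc.le] at hcm
    have := (hf_pos c hcm).ne'
    simp only [hH]
    field_simp
    ring
  have hparts := integral_mul_eq_of_subgradient hc.le hsub hf_int
  simp only [← hF] at hparts
  rw [hF cu, hf_one, mul_one] at hparts
  have hρ_nonneg : 0 ≤ ρ cu q := by
    simpa [hU] using hIR cu (right_mem_Icc.2 hc.le) q hqmem
  rw [hT, hHX, hparts]
  refine ⟨by linarith, fun h ↦ by linarith, fun h ↦ by linarith⟩
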